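/- Let α, β > 0 and let K_a, K_b be positive integers. Let T_a and T_b be independent random variables where T_a is Erlang with shape K_a and rate α and T_b is Erlang with shape K_b and rate β. Then the unconditional mean response time of the Poisson counter model satisfies E[min(T_a, T_b)] = (K_a/α) · I_{α/(α+β)}(K_a+1, K_b) + (K_b/β) · I_{β/(α+β)}(K_b+1, K_a). -/

import Mathlib

open MeasureTheory ProbabilityTheory

/-- The regularized incomplete beta function
`I_q(a,b) = (∫₀¹ t^(a-1)(1-t)^(b-1) dt)⁻¹ · ∫₀^q t^(a-1)(1-t)^(b-1) dt`. -/
noncomputable def regIncBeta (q a b : ℝ) : ℝ :=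
  (∫ t in (0:ℝ)..1, t ^ (a - 1) * (1 - t) ^ (b - 1))⁻¹ *
    ∫ t in (0:ℝ)..q, t ^ (a - 1) * (1 - t) ^ (b - 1)

lemma beta_int_eq (a b : ℝ) (ha : 0 < a) (hb : 0 < b) :
    (∫ t in (0:ℝ)..1, t ^ (a - 1) * (1 - t) ^ (b - 1)) = ProbabilityTheory.beta a b := by
  rw [beta_eq_betaIntegralReal a b ha hb, Complex.betaIntegral]
  have : (∫ x in (0:ℝ)..1, (x:ℂ) ^ ((a:ℂ) - 1) * (1 - (x:ℂ)) ^ ((b:ℂ) - 1)) =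
      ((∫ t in (0:ℝ)..1, t ^ (a - 1) * (1 - t) ^ (b - 1) : ℝ) : ℂ) := by
    rw [← intervalIntegral.integral_ofReal]
    apply intervalIntegral.integral_congr
    intro x hx
    rw [Set.uIcc_of_le zero_le_one] at hx
    have h1 : 0 ≤ 1 - x := by linarith [hx.2]
    simp only
    push_cast
    rw [Complex.ofReal_cpow hx.1, Complex.ofReal_cpow h1]
    push_cast
    rfl
  rw [this, Complex.ofReal_re]

lemma gammaPDF_meas (a r : ℝ) : Measurable (gammaPDF a r) :=
  (measurable_gammaPDFReal a r).ennreal_ofReal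

lemma image_scale (x : ℝ) (hx : 0 < x) : (fun s : ℝ => x * s) '' Set.Ioi 1 = Set.Ioi x := by
  ext y
  simp only [Set.mem_image, Set.mem_Ioi]
  constructor
  · rintro ⟨s, hs, rfl⟩
    nlinarith
  · intro h
    exact ⟨y / x, by rwa [lt_div_iff₀ hx, one_mul], by field_simp⟩

lemma image_q (α β : ℝ) (hα : 0 < α) (hβ : 0 < β) :
    (fun s : ℝ => α / (α + β * s)) '' Set.Ioi 1 = Set.Ioo 0 (α / (α + β)) := by
  ext y
  simp only [Set.mem_image, Set.mem_Ioi, Set.mem_Ioo]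
  constructor
  · rintro ⟨s, hs, rfl⟩
    have : 0 < β * s := by positivity
    refine ⟨by positivity, ?_⟩
    apply div_lt_div_of_pos_left hα (by positivity)
    nlinarith
  · rintro ⟨h0, h1⟩
    refine ⟨α * (1 - y) / (β * y), ?_, ?_⟩
    · rw [lt_div_iff₀ (by positivity)] at h1 ⊢
      linarith
    · field_simp
      ring

lemma tail_scale (b β x : ℝ) (hx : 0 < x) :
    gammaMeasure b β (Set.Ioi x) =
      ∫⁻ s in Set.Ioi (1:ℝ), ENNReal.ofReal x * gammaPDF b β (x * s) := by
  rw [gammaMeasure, withDensity_apply _ measurableSet_Ioi, ← image_scale x hx,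
    lintegral_image_eq_lintegral_abs_deriv_mul (f' := fun _ => x) measurableSet_Ioi]
  · simp only [abs_of_pos hx]
  · intro s _
    simpa using ((hasDerivAt_id s).const_mul x).hasDerivWithinAt
  · intro s _ t _ h
    exact mul_left_cancel₀ hx.ne' h

lemma alg1 (a b α β x s : ℝ) (ha : 0 < a) (hb : 0 < b) (hα : 0 < α) (hβ : 0 < β)
    (hx : 0 < x) (hs : 1 < s) :
    gammaPDFReal a α x * (x * (x * gammaPDFReal b β (x * s))) =
      (α ^ a * β ^ b / (Real.Gamma a * Real.Gamma b) * s ^ (b - 1) *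
        (Real.Gamma (a + b + 1) / (α + β * s) ^ (a + b + 1))) *
        gammaPDFReal (a + b + 1) (α + β * s) x := by
  have hs0 : 0 < s := by linarith
  have hr : 0 < α + β * s := by positivity
  have h1 := Real.Gamma_pos_of_pos ha
  have h2 := Real.Gamma_pos_of_pos hb
  have h3 : 0 < Real.Gamma (a + b + 1) := Real.Gamma_pos_of_pos (by positivity)
  have h4 := Real.rpow_pos_of_pos hr (a + b + 1)
  unfold gammaPDFReal
  rw [if_pos hx.le, if_pos (by positivity), if_pos hx.le, Real.mul_rpow hx.le hs0.le]
  have e1 : x ^ (a + b + 1 - 1) = x ^ (a - 1) * x ^ (b - 1) * x * x := by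
    rw [← Real.rpow_add hx, ← Real.rpow_add_one hx.ne', ← Real.rpow_add_one hx.ne']
    congr 1; ring
  have e2 : Real.exp (-((α + β * s) * x)) = Real.exp (-(α * x)) * Real.exp (-(β * (x * s))) := by
    rw [← Real.exp_add]; congr 1; ring
  rw [e1, e2]
  field_simp

lemma alg2 (a b α β s : ℝ) (ha : 0 < a) (hb : 0 < b) (hα : 0 < α) (hβ : 0 < β) (hs : 1 < s) :
    (α ^ a * β ^ b / (Real.Gamma a * Real.Gamma b) * s ^ (b - 1) *
        (Real.Gamma (a + b + 1) / (α + β * s) ^ (a + b + 1))) =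
      (a / α * (ProbabilityTheory.beta (a + 1) b)⁻¹) * (|-(α * β) / (α + β * s) ^ 2| *
        ((α / (α + β * s)) ^ (a + 1 - 1) * (1 - α / (α + β * s)) ^ (b - 1))) := by
  have hs0 : 0 < s := by linarith
  have hr : 0 < α + β * s := by positivity
  have h1 := Real.Gamma_pos_of_pos ha
  have h2 := Real.Gamma_pos_of_pos hb
  have h3 : 0 < Real.Gamma (a + b + 1) := Real.Gamma_pos_of_pos (by positivity)
  have e0 : 1 - α / (α + β * s) = β * s / (α + β * s) := by field_simp; ring
  have e1 : |-(α * β) / (α + β * s) ^ 2| = α * β / (α + β * s) ^ 2 := by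
    rw [neg_div, abs_neg, abs_of_pos (by positivity)]
  rw [e0, e1, Real.div_rpow hα.le hr.le, Real.div_rpow (by positivity) hr.le,
    Real.mul_rpow hβ.le hs0.le, ProbabilityTheory.beta, Real.Gamma_add_one ha.ne']
  have e2 : (α + β * s) ^ (a + b + 1) =
      (α + β * s) ^ (a + 1 - 1) * (α + β * s) ^ (b - 1) * (α + β * s) ^ 2 := by
    rw [← Real.rpow_add hr, ← Real.rpow_natCast, ← Real.rpow_add hr]
    congr 1; push_cast; ring
  have e3 : β ^ b = β ^ (b - 1) * β := by
    rw [← Real.rpow_add_one hβ.ne']; congr 1; ring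
  have e4 : a + 1 + b = a + b + 1 := by ring
  have e5 : a + 1 - 1 = a := by ring
  have p1 := Real.rpow_pos_of_pos hr a
  have p2 := Real.rpow_pos_of_pos hr (b - 1)
  rw [e2, e3, e4, e5]
  field_simp

lemma regIncBeta_lint (q a b : ℝ) (ha : 0 < a) (hb : 1 ≤ b) (hq : 0 ≤ q) (hq1 : q ≤ 1) :
    0 ≤ regIncBeta q (a + 1) b ∧
    ENNReal.ofReal (regIncBeta q (a + 1) b) =
      ENNReal.ofReal (ProbabilityTheory.beta (a + 1) b)⁻¹ *
       ∫⁻ t in Set.Ioo 0 q, ENNReal.ofReal (t ^ (a + 1 - 1) * (1 - t) ^ (b - 1)) := by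
  have hbp : 0 < ProbabilityTheory.beta (a + 1) b := beta_pos (by linarith) (by linarith)
  have hnn : ∀ t ∈ Set.Ioc 0 q, 0 ≤ t ^ (a + 1 - 1) * (1 - t) ^ (b - 1) := by
    intro t ht
    exact mul_nonneg (Real.rpow_nonneg ht.1.le _) (Real.rpow_nonneg (by linarith [ht.2]) _)
  have hc : Continuous (fun t : ℝ => t ^ (a + 1 - 1) * (1 - t) ^ (b - 1)) :=
    (Real.continuous_rpow_const (by linarith)).mul
      ((continuous_const.sub continuous_id).rpow_const (fun _ => Or.inr (by linarith)))
  unfold regIncBeta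
  rw [beta_int_eq _ _ (by linarith) (by linarith), intervalIntegral.integral_of_le hq]
  constructor
  · exact mul_nonneg (by positivity) (setIntegral_nonneg measurableSet_Ioc hnn)
  · rw [ENNReal.ofReal_mul (by positivity), ofReal_integral_eq_lintegral_ofReal,
      setLIntegral_congr Ioo_ae_eq_Ioc]
    · exact (hc.integrableOn_Icc).mono_set Set.Ioc_subset_Icc_self
    · exact (ae_restrict_iff' measurableSet_Ioc).2 (Filter.Eventually.of_forall hnn)

lemma half (a b α β : ℝ) (ha : 0 < a) (hb : 1 ≤ b) (hα : 0 < α) (hβ : 0 < β) :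
    ∫⁻ x, ENNReal.ofReal x * gammaMeasure b β (Set.Ioi x) ∂(gammaMeasure a α) =
      ENNReal.ofReal (a / α * regIncBeta (α / (α + β)) (a + 1) b) := by
  have hb0 : 0 < b := by linarith
  have := isProbabilityMeasure_gammaMeasure hb0 hβ
  have hm : Measurable (fun x : ℝ => ENNReal.ofReal x * gammaMeasure b β (Set.Ioi x)) := by
    refine ENNReal.measurable_ofReal.mul ?_
    exact Antitone.measurable (fun x y h => measure_mono (Set.Ioi_subset_Ioi h))
  rw [gammaMeasure, lintegral_withDensity_eq_lintegral_mul _ (gammaPDF_meas a α) hm]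
  have hq1 : α / (α + β) ≤ 1 := by rw [div_le_one (by positivity)]; linarith
  obtain ⟨hn, hl⟩ := regIncBeta_lint (α / (α + β)) a b ha hb (by positivity) hq1
  have hbp : 0 < ProbabilityTheory.beta (a + 1) b := beta_pos (by linarith) (by linarith)
  rw [ENNReal.ofReal_mul (by positivity), hl, ← mul_assoc, ← ENNReal.ofReal_mul (by positivity),
    ← image_q α β hα hβ, lintegral_image_eq_lintegral_abs_deriv_mul
      (f' := fun s => -(α * β) / (α + β * s) ^ 2) measurableSet_Ioi]
  rotate_left
  · intro s hs
    have hs' : (1:ℝ) < s := hs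
    have hr : α + β * s ≠ 0 := by positivity
    have := ((hasDerivAt_const s α).div (((hasDerivAt_id s).const_mul β).const_add α) hr)
    exact (this.congr_deriv (by simp)).hasDerivWithinAt
  · intro s hs t ht h
    have hs' : (1:ℝ) < s := hs
    have ht' : (1:ℝ) < t := ht
    have hr : 0 < α + β * s := by positivity
    have hr2 : 0 < α + β * t := by positivity
    rw [div_eq_div_iff hr.ne' hr2.ne'] at h
    have := mul_left_cancel₀ hα.ne' h
    have : β * s = β * t := by linarith
    exact mul_left_cancel₀ hβ.ne' this
  rw [← lintegral_const_mul' _ _ ENNReal.ofReal_ne_top]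
  set C : ℝ → ℝ := fun s => α ^ a * β ^ b / (Real.Gamma a * Real.Gamma b) * s ^ (b - 1) *
        (Real.Gamma (a + b + 1) / (α + β * s) ^ (a + b + 1)) with hC
  have hG : Measurable (Function.uncurry (fun x s : ℝ => gammaPDF a α x * (ENNReal.ofReal x *
      (ENNReal.ofReal x * gammaPDF b β (x * s))))) := by
    have h1 := gammaPDF_meas a α
    have h2 := gammaPDF_meas b β
    unfold Function.uncurry
    fun_prop
  have s1 : ∫⁻ x, (gammaPDF a α * fun x : ℝ => ENNReal.ofReal x * gammaMeasure b β (Set.Ioi x)) x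
      = ∫⁻ x in Set.Ioi 0, ∫⁻ s in Set.Ioi (1:ℝ), gammaPDF a α x * (ENNReal.ofReal x *
        (ENNReal.ofReal x * gammaPDF b β (x * s))) := by
    rw [← lintegral_indicator measurableSet_Ioi]
    congr 1
    ext x
    simp only [Pi.mul_apply, Set.indicator, Set.mem_Ioi]
    split_ifs with hx
    · rw [lintegral_const_mul' _ _ (by simp [gammaPDF]), lintegral_const_mul' _ _ (by simp),
        tail_scale b β x hx]
    · simp [ENNReal.ofReal_of_nonpos (not_lt.1 hx)]
  rw [s1, lintegral_lintegral_swap hG.aemeasurable]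
  apply setLIntegral_congr_fun measurableSet_Ioi
  intro s hs
  have hs' : (1:ℝ) < s := hs
  have hs0 : 0 < s := by linarith
  have hr : 0 < α + β * s := by positivity
  have h1 := Real.Gamma_pos_of_pos ha
  have h2 := Real.Gamma_pos_of_pos hb0
  have h3 : 0 < Real.Gamma (a + b + 1) := Real.Gamma_pos_of_pos (by positivity)
  have hCs : 0 ≤ C s := by simp only [hC]; positivity
  have s2 : ∫⁻ x in Set.Ioi 0, gammaPDF a α x * (ENNReal.ofReal x *
        (ENNReal.ofReal x * gammaPDF b β (x * s))) = ENNReal.ofReal (C s) := by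
    have : ∫⁻ x in Set.Ioi 0, gammaPDF a α x * (ENNReal.ofReal x *
        (ENNReal.ofReal x * gammaPDF b β (x * s))) =
        ∫⁻ x in Set.Ioi 0, ENNReal.ofReal (C s) * gammaPDF (a + b + 1) (α + β * s) x := by
      apply setLIntegral_congr_fun measurableSet_Ioi
      intro x hx
      have hx' : 0 < x := hx
      simp only [gammaPDF]
      rw [← ENNReal.ofReal_mul hx'.le, ← ENNReal.ofReal_mul hx'.le,
        ← ENNReal.ofReal_mul (gammaPDFReal_nonneg ha hα x), ← ENNReal.ofReal_mul hCs,
        alg1 a b α β x s ha hb0 hα hβ hx' hs']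
    rw [this, lintegral_const_mul' _ _ ENNReal.ofReal_ne_top]
    have h4 := lintegral_gammaPDF_eq_one (a := a + b + 1) (by positivity) hr
    rw [← lintegral_add_compl _ (measurableSet_Ici (a := (0:ℝ))), Set.compl_Ici,
      lintegral_gammaPDF_of_nonpos le_rfl, add_zero] at h4
    rw [setLIntegral_congr Ioi_ae_eq_Ici, h4, mul_one]
  simp only
  rw [s2, ← ENNReal.ofReal_mul (abs_nonneg _), ← ENNReal.ofReal_mul (by positivity)]
  simp only [hC]
  rw [alg2 a b α β s ha hb0 hα hβ hs']

lemma gamma_ae_nonneg (a r : ℝ) : ∀ᵐ x ∂(gammaMeasure a r), 0 ≤ x := by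
  rw [ae_iff]
  have : {x : ℝ | ¬ 0 ≤ x} = Set.Iio 0 := by ext; simp
  rw [this, gammaMeasure, withDensity_apply _ measurableSet_Iio,
    lintegral_gammaPDF_of_nonpos le_rfl]

lemma gamma_Ici (a r x : ℝ) : gammaMeasure a r (Set.Ici x) = gammaMeasure a r (Set.Ioi x) := by
  rw [gammaMeasure, withDensity_apply _ measurableSet_Ioi, withDensity_apply _ measurableSet_Ici,
    setLIntegral_congr Ioi_ae_eq_Ici]

/-- In the Poisson counter model, with independent Erlang arrival times `T_a` (shape `K_a`,
rate `α`) and `T_b` (shape `K_b`, rate `β`), the unconditional mean response time is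
`E[min(T_a, T_b)] = (K_a/α) I_{α/(α+β)}(K_a+1, K_b) + (K_b/β) I_{β/(α+β)}(K_b+1, K_a)`. -/
theorem poisson_counter_mean_response_time {Ω : Type*} [MeasurableSpace Ω]
    (μ : Measure Ω) [IsProbabilityMeasure μ] (Ta Tb : Ω → ℝ)
    (hTa : Measurable Ta) (hTb : Measurable Tb)
    (Ka Kb : ℕ) (hKa : 1 ≤ Ka) (hKb : 1 ≤ Kb) (α β : ℝ) (hα : 0 < α) (hβ : 0 < β)
    (hindep : IndepFun Ta Tb μ)
    (hlawA : μ.map Ta = gammaMeasure Ka α)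
    (hlawB : μ.map Tb = gammaMeasure Kb β) :
    ∫ ω, min (Ta ω) (Tb ω) ∂μ =
      (Ka : ℝ) / α * regIncBeta (α / (α + β)) ((Ka : ℝ) + 1) (Kb : ℝ) +
        (Kb : ℝ) / β * regIncBeta (β / (α + β)) ((Kb : ℝ) + 1) (Ka : ℝ) := by
  have hA0 : (0:ℝ) < Ka := by exact_mod_cast hKa
  have hB0 : (0:ℝ) < Kb := by exact_mod_cast hKb
  have hA1 : (1:ℝ) ≤ Ka := by exact_mod_cast hKa
  have hB1 : (1:ℝ) ≤ Kb := by exact_mod_cast hKb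
  have := isProbabilityMeasure_gammaMeasure hA0 hα
  have := isProbabilityMeasure_gammaMeasure hB0 hβ
  have hTa0 : ∀ᵐ ω ∂μ, 0 ≤ Ta ω :=
    ae_of_ae_map hTa.aemeasurable (by rw [hlawA]; exact gamma_ae_nonneg _ _)
  have hTb0 : ∀ᵐ ω ∂μ, 0 ≤ Tb ω :=
    ae_of_ae_map hTb.aemeasurable (by rw [hlawB]; exact gamma_ae_nonneg _ _)
  have hjoint := (indepFun_iff_map_prod_eq_prod_map_map hTa.aemeasurable hTb.aemeasurable).1 hindep
  rw [hlawA, hlawB] at hjoint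
  have hnn : 0 ≤ᵐ[μ] fun ω => min (Ta ω) (Tb ω) := by
    filter_upwards [hTa0, hTb0] with ω h1 h2
    exact le_min h1 h2
  rw [integral_eq_lintegral_of_nonneg_ae hnn (hTa.min hTb).aestronglyMeasurable]
  have hS : MeasurableSet {p : ℝ × ℝ | p.1 < p.2} := measurableSet_lt measurable_fst measurable_snd
  have hm1 : Measurable ({p : ℝ × ℝ | p.1 < p.2}.indicator
      (fun p => ENNReal.ofReal p.1)) := (by fun_prop : Measurable _).indicator hS
  have hm2 : Measurable ({p : ℝ × ℝ | p.1 < p.2}ᶜ.indicator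
      (fun p => ENNReal.ofReal p.2)) := (by fun_prop : Measurable _).indicator hS.compl
  have e1 : ∫⁻ ω, ENNReal.ofReal (min (Ta ω) (Tb ω)) ∂μ =
      ∫⁻ p, ({p : ℝ × ℝ | p.1 < p.2}.indicator (fun p => ENNReal.ofReal p.1) p +
        {p : ℝ × ℝ | p.1 < p.2}ᶜ.indicator (fun p => ENNReal.ofReal p.2) p)
        ∂((gammaMeasure Ka α).prod (gammaMeasure Kb β)) := by
    rw [← hjoint]
    refine Eq.trans ?_ (lintegral_map (hm1.add hm2) (hTa.prodMk hTb)).symm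
    congr 1
    ext ω
    by_cases h : Ta ω < Tb ω
    · simp [Set.indicator, h, h.le]
    · simp [Set.indicator, h, not_lt.1 h]
  have e2 : ∫⁻ p, {p : ℝ × ℝ | p.1 < p.2}.indicator (fun p => ENNReal.ofReal p.1) p
        ∂((gammaMeasure Ka α).prod (gammaMeasure Kb β)) =
      ENNReal.ofReal ((Ka : ℝ) / α * regIncBeta (α / (α + β)) ((Ka : ℝ) + 1) (Kb : ℝ)) := by
    rw [lintegral_prod _ hm1.aemeasurable, ← half _ _ _ _ hA0 hB1 hα hβ]
    congr 1
    ext x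
    rw [← lintegral_indicator_const measurableSet_Ioi]
    rfl
  have e3 : ∫⁻ p, {p : ℝ × ℝ | p.1 < p.2}ᶜ.indicator (fun p => ENNReal.ofReal p.2) p
        ∂((gammaMeasure Ka α).prod (gammaMeasure Kb β)) =
      ENNReal.ofReal ((Kb : ℝ) / β * regIncBeta (β / (α + β)) ((Kb : ℝ) + 1) (Ka : ℝ)) := by
    rw [lintegral_prod_symm _ hm2.aemeasurable, add_comm α β, ← half _ _ _ _ hB0 hA1 hβ hα]
    congr 1
    ext y
    rw [← gamma_Ici, ← lintegral_indicator_const measurableSet_Ici]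
    congr 1
    ext x
    simp [Set.indicator]
  rw [e1, lintegral_add_left hm1, e2, e3, ENNReal.toReal_add ENNReal.ofReal_ne_top
    ENNReal.ofReal_ne_top, ENNReal.toReal_ofReal, ENNReal.toReal_ofReal]
  · refine mul_nonneg (by positivity) (regIncBeta_lint _ _ _ hB0 hA1 (by positivity) ?_).1
    rw [div_le_one (by positivity)]; linarith
  · refine mul_nonneg (by positivity) (regIncBeta_lint _ _ _ hA0 hB1 (by positivity) ?_).1
    rw [div_le_one (by positivity)]; linarith
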